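/- Two finite metric spaces (X,d_X) and (Y,d_Y) of cardinality n, with canonical finite metric spaces (C_X,d_{C_X}) and (C_Y,d_{C_Y}) weakly isometric to X and to Y respectively, are weakly isometric if and only if K̃_n(C_X) = K̃_n(C_Y), where K̃_n is the n-th reduced curvature set. -/

import Mathlib

open scoped NNReal

def WeaklyIsometric (X Y : Type*) [MetricSpace X] [MetricSpace Y] : Prop :=
  ∃ (φ : X ≃ Y) (ψ : ℝ≥0 → ℝ≥0), StrictMono ψ ∧
    ∀ x₁ x₂ : X, ψ (nndist x₁ x₂) = nndist (φ x₁) (φ x₂)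

def distSet (X : Type*) [MetricSpace X] : Set ℝ :=
  {r | ∃ x₁ x₂ : X, x₁ ≠ x₂ ∧ dist x₁ x₂ = r}

def IsCanonical (X : Type*) [MetricSpace X] [Fintype X] : Prop :=
  distSet X = Nat.cast ''
    Set.Icc (2 * Nat.choose (Fintype.card X) 2 - (distSet X).ncard + 1)
            (2 * Nat.choose (Fintype.card X) 2)

/-- The `m`-th reduced curvature set of a metric space: all `m × m` matrices of pairwise
distances of `m`-tuples of pairwise distinct points. -/
def curvRed (X : Type*) [MetricSpace X] (m : ℕ) : Set (Matrix (Fin m) (Fin m) ℝ) :=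
  {M | ∃ x : Fin m → X, Function.Injective x ∧ ∀ i j, M i j = dist (x i) (x j)}

/-- A strictly increasing function on a finite subset of `ℝ≥0`, normalised at `0`, extends to a
strictly increasing function on `ℝ≥0`. -/
theorem StrictMonoOn.exists_strictMono_eqOn_finset (f : ℝ≥0 → ℝ≥0) (hf0 : f 0 = 0)
    (S : Finset ℝ≥0) (hf : StrictMonoOn f (insert 0 (S : Set ℝ≥0))) :
    ∃ ψ : ℝ≥0 → ℝ≥0, StrictMono ψ ∧ ψ 0 = 0 ∧ Set.EqOn ψ f S := by
  induction S using Finset.induction_on_max with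
  | empty => exact ⟨id, strictMono_id, rfl, by simp⟩
  | insert a S hlt ih =>
    obtain ⟨ψ, hψ, hψ0, hψf⟩ := ih (hf.mono (by
      intro x hx
      simp only [Set.mem_insert_iff, Finset.mem_coe, Finset.mem_insert] at hx ⊢
      tauto))
    rcases eq_or_ne a 0 with rfl | ha
    · refine ⟨ψ, hψ, hψ0, fun x hx => ?_⟩
      rcases Finset.mem_insert.1 hx with rfl | hx
      · rw [hψ0, hf0]
      · exact hψf hx
    have ha0 : 0 < a := pos_iff_ne_zero.2 ha
    obtain ⟨m, hm, hmax⟩ : ∃ m ∈ insert 0 S, ∀ x ∈ insert 0 S, x ≤ m :=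
      (insert 0 S).exists_max_image id (Finset.insert_nonempty 0 S)
    have hma : m < a := by
      rcases Finset.mem_insert.1 hm with rfl | h
      · exact ha0
      · exact hlt m h
    have hψm : ψ m = f m := by
      rcases Finset.mem_insert.1 hm with rfl | h
      · rw [hψ0, hf0]
      · exact hψf h
    have hfm : f m < f a := by
      refine hf ?_ (by simp) hma
      simp only [Finset.mem_insert] at hm
      simp only [Set.mem_insert_iff, Finset.mem_coe, Finset.mem_insert]
      tauto
    have hc : 0 < (f a - f m) / (a - m) :=
      div_pos (tsub_pos_of_lt hfm) (tsub_pos_of_lt hma)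
    refine ⟨fun t => if t ≤ m then ψ t else f m + (t - m) * ((f a - f m) / (a - m)),
      ?_, by simp [hψ0], ?_⟩
    · intro s t hst
      by_cases hs : s ≤ m <;> by_cases ht : t ≤ m
      · simpa [hs, ht] using hψ hst
      · simp only [hs, ht, if_true, if_false]
        calc ψ s ≤ f m := hψm ▸ hψ.monotone hs
          _ < _ := lt_add_of_pos_right _ (mul_pos (tsub_pos_of_lt (not_le.1 ht)) hc)
      · exact absurd (hst.le.trans ht) hs
      · simp only [hs, ht, if_false]
        have := tsub_lt_tsub_right_of_le (not_le.1 hs).le hst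
        gcongr
    · intro x hx
      rcases Finset.mem_insert.1 hx with rfl | hx
      · simp only [not_le.2 hma, if_false]
        rw [mul_div_cancel₀ _ (tsub_pos_of_lt hma).ne', add_tsub_cancel_of_le hfm.le]
      · simp only [hmax x (Finset.mem_insert_of_mem hx), if_true]
        exact hψf hx

/-- A strictly increasing function mapping a finite set onto itself fixes it pointwise. -/
theorem StrictMono.eqOn_id_of_image_eq {α : Type*} [LinearOrder α] {f : α → α} (hf : StrictMono f)
    {s : Set α} (hs : s.Finite) (h : f '' s = s) : Set.EqOn f id s := by
  have : Finite s := hs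
  let e : s ≃o s := (hf.strictMonoOn s).orderIso f s |>.trans (OrderIso.setCongr _ _ h)
  intro x hx
  have : e = OrderIso.refl s := Subsingleton.elim _ _
  exact congrArg Subtype.val (DFunLike.congr_fun this ⟨x, hx⟩)

namespace WeaklyIsometric

variable {X Y Z : Type*} [MetricSpace X] [MetricSpace Y] [MetricSpace Z]

theorem trans (h₁ : WeaklyIsometric X Y) (h₂ : WeaklyIsometric Y Z) : WeaklyIsometric X Z := by
  obtain ⟨φ₁, ψ₁, hm₁, h₁⟩ := h₁
  obtain ⟨φ₂, ψ₂, hm₂, h₂⟩ := h₂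
  exact ⟨φ₁.trans φ₂, ψ₂ ∘ ψ₁, hm₂.comp hm₁, fun a b => by simp [h₁, h₂]⟩

theorem symm [Finite X] (h : WeaklyIsometric X Y) : WeaklyIsometric Y X := by
  obtain ⟨φ, ψ, hm, h⟩ := h
  cases isEmpty_or_nonempty X with
  | inl hX => exact ⟨φ.symm, id, strictMono_id, fun y => isEmptyElim (φ.symm y)⟩
  | inr hX =>
    obtain ⟨x₀⟩ := hX
    have hψ0 : ψ 0 = 0 := by simpa using h x₀ x₀
    have hleft := Function.leftInverse_invFun hm.injective
    have hfin : (Set.range fun p : X × X => ψ (nndist p.1 p.2)).Finite := Set.finite_range _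
    obtain ⟨g, hg, -, hgf⟩ := StrictMonoOn.exists_strictMono_eqOn_finset (Function.invFun ψ)
      (by simpa [hψ0] using hleft 0) hfin.toFinset (by
        have hsub : insert 0 (hfin.toFinset : Set ℝ≥0) ⊆ Set.range ψ := by
          rw [Set.insert_subset_iff, hfin.coe_toFinset]
          exact ⟨⟨0, hψ0⟩, Set.range_subset_iff.2 fun p => ⟨_, rfl⟩⟩
        intro a ha b hb hab
        obtain ⟨a, rfl⟩ := hsub ha
        obtain ⟨b, rfl⟩ := hsub hb
        rw [hleft, hleft]
        exact hm.lt_iff_lt.1 hab)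
    refine ⟨φ.symm, g, hg, fun y₁ y₂ => ?_⟩
    have key := h (φ.symm y₁) (φ.symm y₂)
    rw [φ.apply_symm_apply, φ.apply_symm_apply] at key
    rw [← key, hgf (by simp), hleft]

end WeaklyIsometric

theorem finite_distSet (X : Type*) [MetricSpace X] [Finite X] : (distSet X).Finite :=
  (Set.finite_range fun p : X × X => dist p.1 p.2).subset <| by
    rintro _ ⟨a, b, -, rfl⟩
    exact ⟨(a, b), rfl⟩

theorem distSet_subset_range_coe (X : Type*) [MetricSpace X] :
    distSet X ⊆ Set.range ((↑) : ℝ≥0 → ℝ) := by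
  rintro _ ⟨a, b, -, rfl⟩
  exact ⟨nndist a b, rfl⟩

/-- Weakly isometric canonical spaces are isometric. -/
theorem IsCanonical.nonempty_isometryEquiv {X Y : Type*} [MetricSpace X] [MetricSpace Y]
    [Fintype X] [Fintype Y] (hX : IsCanonical X) (hY : IsCanonical Y)
    (h : WeaklyIsometric X Y) : Nonempty (X ≃ᵢ Y) := by
  obtain ⟨φ, ψ, hm, h⟩ := h
  let D : Set ℝ≥0 := (↑) ⁻¹' distSet X
  have himage : ψ '' D = (↑) ⁻¹' distSet Y := by
    ext r
    constructor
    · rintro ⟨t, ⟨a, b, hab, ht⟩, rfl⟩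
      obtain rfl : nndist a b = t := NNReal.eq ht
      exact ⟨φ a, φ b, φ.injective.ne hab, by rw [h, coe_nndist]⟩
    · rintro ⟨a, b, hab, ht⟩
      obtain rfl : nndist a b = r := NNReal.eq ht
      exact ⟨nndist (φ.symm a) (φ.symm b), ⟨_, _, φ.symm.injective.ne hab, rfl⟩, by simp [h]⟩
  have hcard : (distSet X).ncard = (distSet Y).ncard := by
    rw [← Set.ncard_preimage_of_injective_subset_range NNReal.coe_injective (distSet_subset_range_coe X),
      ← Set.ncard_preimage_of_injective_subset_range NNReal.coe_injective (distSet_subset_range_coe Y), ← himage,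
      Set.ncard_image_of_injective _ hm.injective]
  have hdist : distSet X = distSet Y := by
    rw [hX, hY, hcard, Fintype.card_congr φ]
  have hfix := hm.eqOn_id_of_image_eq
    ((finite_distSet X).preimage NNReal.coe_injective.injOn) (himage.trans (by rw [hdist]))
  refine ⟨⟨φ, Isometry.of_dist_eq fun a b => ?_⟩⟩
  rcases eq_or_ne a b with rfl | hab
  · simp
  · have := hfix (show nndist a b ∈ _ from ⟨a, b, hab, rfl⟩)
    rw [h] at this
    exact congrArg NNReal.toReal this

theorem Isometry.curvRed_subset {X Y : Type*} [MetricSpace X] [MetricSpace Y] {f : X → Y}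
    (hf : Isometry f) (m : ℕ) : curvRed X m ⊆ curvRed Y m := by
  rintro M ⟨x, hx, hM⟩
  exact ⟨f ∘ x, hf.injective.comp hx, fun i j => by simp [hM, hf.dist_eq]⟩

/-- Finite metric spaces of cardinality `n` with the same `n`-th reduced curvature set are
isometric. -/
theorem nonempty_isometryEquiv_of_curvRed_subset {X Y : Type*} [MetricSpace X] [MetricSpace Y]
    [Fintype X] [Fintype Y] {n : ℕ} (hX : Fintype.card X = n) (hY : Fintype.card Y = n)
    (h : curvRed X n ⊆ curvRed Y n) : Nonempty (X ≃ᵢ Y) := by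
  let e : X ≃ Fin n := Fintype.equivFinOfCardEq hX
  obtain ⟨y, hy, hdist⟩ := h (show Matrix.of (fun i j => dist (e.symm i) (e.symm j)) ∈ _ from
    ⟨e.symm, e.symm.injective, fun _ _ => rfl⟩)
  have hbij : Function.Bijective y :=
    (Fintype.bijective_iff_injective_and_card y).2 ⟨hy, by simp [hY]⟩
  exact ⟨⟨e.trans (Equiv.ofBijective y hbij), Isometry.of_dist_eq fun a b => by
    simpa using (hdist (e a) (e b)).symm⟩⟩

theorem IsometryEquiv.weaklyIsometric {X Y : Type*} [MetricSpace X] [MetricSpace Y]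
    (e : X ≃ᵢ Y) : WeaklyIsometric X Y :=
  ⟨e.toEquiv, id, strictMono_id, fun a b => (e.isometry.nndist_eq a b).symm⟩

/-- Two finite metric spaces of cardinality `n` are weakly isometric iff the `n`-th
reduced curvature sets of their canonicalizations agree. -/
theorem weaklyIsometric_iff_curvRed_canonicalizations
    (X Y CX CY : Type*) [MetricSpace X] [MetricSpace Y] [MetricSpace CX] [MetricSpace CY]
    [Fintype X] [Fintype Y] [Fintype CX] [Fintype CY]
    (n : ℕ) (hX : Fintype.card X = n) (hY : Fintype.card Y = n)
    (hCX : IsCanonical CX) (hCY : IsCanonical CY)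
    (h1 : WeaklyIsometric CX X) (h2 : WeaklyIsometric CY Y) :
    WeaklyIsometric X Y ↔ curvRed CX n = curvRed CY n := by
  have hcX : Fintype.card CX = n := by
    obtain ⟨φ, -⟩ := h1
    rw [Fintype.card_congr φ, hX]
  have hcY : Fintype.card CY = n := by
    obtain ⟨φ, -⟩ := h2
    rw [Fintype.card_congr φ, hY]
  constructor
  · intro h
    obtain ⟨e⟩ := hCX.nonempty_isometryEquiv hCY ((h1.trans h).trans h2.symm)
    exact (e.isometry.curvRed_subset n).antisymm (e.symm.isometry.curvRed_subset n)
  · intro h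
    obtain ⟨e⟩ := nonempty_isometryEquiv_of_curvRed_subset hcX hcY h.subset
    exact (h1.symm.trans e.weaklyIsometric).trans h2
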